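/- Completeness of Λ_R' with respect to bi-valued kiobt-models: every Λ_R'-consistent formula of L_R is true at some index of some finite-choice bi-valued kiobt-model. -/

import Mathlib

namespace IEAUST

variable {Agent Mom : Type}

/-- Histories: maximal chains of moments. -/
abbrev Hist (lt : Mom → Mom → Prop) : Type _ := {s : Set Mom // IsMaxChain lt s}

/-- An index is a pair of a moment and a history passing through it. -/
structure Idx (lt : Mom → Mom → Prop) where
  mom : Mom
  hist : Hist lt
  mem : mom ∈ hist.val

/-- The ex ante information set of an agent at an index. -/
def exAnte {lt : Mom → Mom → Prop} (epi : Agent → Idx lt → Idx lt → Prop)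
    (a : Agent) (i : Idx lt) : Set (Idx lt) :=
  {j | ∃ (h'' : Hist lt) (p : j.mom ∈ h''.val), epi a i ⟨j.mom, h'', p⟩}

/-- A kiobt structure: branching time, choices, epistemic relations, intention
topologies and deontic value(s). -/
structure BiKiobtModel (Agent Mom : Type) (lt : Mom → Mom → Prop) where
  ags_fin : Finite Agent
  mom_ne : Nonempty Mom
  lt_irrefl : ∀ m, ¬ lt m m
  lt_trans : ∀ {m₁ m₂ m₃}, lt m₁ m₂ → lt m₂ m₃ → lt m₁ m₃
  no_bb : ∀ {m₁ m₂ m}, lt m₁ m → lt m₂ m → m₁ = m₂ ∨ lt m₁ m₂ ∨ lt m₂ m₁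
  Choice : Agent → Mom → Set (Set (Hist lt))
  choice_sub : ∀ a m, ∀ L ∈ Choice a m, ∀ h ∈ L, m ∈ (h : Hist lt).val
  choice_ne : ∀ a m, ∀ L ∈ Choice a m, L.Nonempty
  choice_cover : ∀ a m (h : Hist lt), m ∈ h.val → ∃ L ∈ Choice a m, h ∈ L
  choice_disj : ∀ a m, ∀ L ∈ Choice a m, ∀ L' ∈ Choice a m, ∀ h, h ∈ L → h ∈ L' → L = L'
  nc : ∀ a m m', lt m m' → ∀ h h' : Hist lt, m ∈ h.val → m ∈ h'.val →
        m' ∈ h.val → m' ∈ h'.val → ∀ L ∈ Choice a m, h ∈ L → h' ∈ L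
  ia : ∀ m (s : Agent → Set (Hist lt)), (∀ a, s a ∈ Choice a m) → (⋂ a, s a).Nonempty
  epi : Agent → Idx lt → Idx lt → Prop
  epi_equiv : ∀ a, Equivalence (epi a)
  oac : ∀ a (i j : Idx lt), epi a i j → ∀ L ∈ Choice a i.mom, i.hist ∈ L →
        ∀ h' ∈ L, ∀ p : i.mom ∈ (h' : Hist lt).val, epi a ⟨i.mom, h', p⟩ j
  unifH : ∀ a (i j : Idx lt), epi a i j → ∀ (h' : Hist lt) (p : i.mom ∈ h'.val),
        ∃ (h'' : Hist lt) (q : j.mom ∈ h''.val), epi a ⟨i.mom, h', p⟩ ⟨j.mom, h'', q⟩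
  tau : Agent → Idx lt → Set (Set (Idx lt))
  tau_sub : ∀ a i, ∀ U ∈ tau a i, U ⊆ exAnte epi a i
  tau_univ : ∀ a i, exAnte epi a i ∈ tau a i
  tau_empty : ∀ a i, (∅ : Set (Idx lt)) ∈ tau a i
  tau_inter : ∀ a i U V, U ∈ tau a i → V ∈ tau a i → U ∩ V ∈ tau a i
  tau_sUnion : ∀ a i (S : Set (Set (Idx lt))), S ⊆ tau a i → ⋃₀ S ∈ tau a i
  tau_ci : ∀ a i U V, U ∈ tau a i → V ∈ tau a i → U.Nonempty → V.Nonempty → (U ∩ V).Nonempty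
  tau_ki : ∀ a i j, exAnte epi a i = exAnte epi a j → tau a i = tau a j
  ValueO : Hist lt → ℝ
  ValueS : Hist lt → ℝ
  val : ℕ → Set (Idx lt)

variable {lt : Mom → Mom → Prop}

/-- The model is finite-choice if every choice partition has finitely many cells. -/
def FiniteChoice (M : BiKiobtModel Agent Mom lt) : Prop :=
  ∀ a m, (M.Choice a m).Finite

/-- `State^m_β`. -/
def stateSet (M : BiKiobtModel Agent Mom lt) (b : Agent) (m : Mom) : Set (Set (Hist lt)) :=
  {S | ∃ s : Agent → Set (Hist lt), (∀ a, s a ∈ M.Choice a m) ∧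
        S = ⋂ a ∈ {a : Agent | a ≠ b}, s a}

/-- `X ≤ Y` (ordering used for objective dominance). -/
def leVal (M : BiKiobtModel Agent Mom lt) (X Y : Set (Hist lt)) : Prop :=
  ∀ h ∈ X, ∀ h' ∈ Y, M.ValueO h ≤ M.ValueO h'

/-- `X ≤_s Y` (ordering used for subjective dominance). -/
def leValS (M : BiKiobtModel Agent Mom lt) (X Y : Set (Hist lt)) : Prop :=
  ∀ h ∈ X, ∀ h' ∈ Y, M.ValueS h ≤ M.ValueS h'

/-- Objective dominance `L ≼ L'`. -/
def domO (M : BiKiobtModel Agent Mom lt) (a : Agent) (m : Mom) (L L' : Set (Hist lt)) : Prop :=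
  ∀ S ∈ stateSet M a m, leVal M (L ∩ S) (L' ∩ S)

/-- Strict objective dominance `L ≺ L'`. -/
def sdomO (M : BiKiobtModel Agent Mom lt) (a : Agent) (m : Mom) (L L' : Set (Hist lt)) : Prop :=
  domO M a m L L' ∧ ¬ domO M a m L' L

/-- `Optimal^m_α`. -/
def optimal (M : BiKiobtModel Agent Mom lt) (a : Agent) (m : Mom) : Set (Set (Hist lt)) :=
  {L | L ∈ M.Choice a m ∧ ¬ ∃ L' ∈ M.Choice a m, sdomO M a m L L'}

/-- `m ∼_α m'` for moments. -/
def momRel (M : BiKiobtModel Agent Mom lt) (a : Agent) (m m' : Mom) : Prop :=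
  ∃ (i j : Idx lt), i.mom = m ∧ j.mom = m' ∧ M.epi a i j

/-- The epistemic cluster `[L]^m_α` of `L ⊆ H_{m*}` at `m`. -/
def cluster (M : BiKiobtModel Agent Mom lt) (a : Agent) (mstar : Mom)
    (L : Set (Hist lt)) (m : Mom) : Set (Hist lt) :=
  {h | ∃ (p : m ∈ h.val) (hs : Hist lt), hs ∈ L ∧
        ∃ q : mstar ∈ hs.val, M.epi a ⟨mstar, hs, q⟩ ⟨m, h, p⟩}

/-- Subjective dominance `L ≼_s L'`. -/
def domS (M : BiKiobtModel Agent Mom lt) (a : Agent) (mstar : Mom)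
    (L L' : Set (Hist lt)) : Prop :=
  ∀ m, momRel M a mstar m → ∀ S ∈ stateSet M a m,
    leValS M (cluster M a mstar L m ∩ S) (cluster M a mstar L' m ∩ S)

/-- Strict subjective dominance `L ≺_s L'`. -/
def sdomS (M : BiKiobtModel Agent Mom lt) (a : Agent) (mstar : Mom)
    (L L' : Set (Hist lt)) : Prop :=
  domS M a mstar L L' ∧ ¬ domS M a mstar L' L

/-- `SOptimal^m_α`. -/
def soptimal (M : BiKiobtModel Agent Mom lt) (a : Agent) (m : Mom) : Set (Set (Hist lt)) :=
  {L | L ∈ M.Choice a m ∧ ¬ ∃ L' ∈ M.Choice a m, sdomS M a m L L'}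

/-- Formulas of the language `L_R` (atomic propositions indexed by `ℕ`). -/
inductive Formula (Agent : Type) : Type
  | atom : ℕ → Formula Agent
  | neg : Formula Agent → Formula Agent
  | conj : Formula Agent → Formula Agent → Formula Agent
  | box : Formula Agent → Formula Agent
  | stit : Agent → Formula Agent → Formula Agent
  | know : Agent → Formula Agent → Formula Agent
  | intend : Agent → Formula Agent → Formula Agent
  | oughtO : Agent → Formula Agent → Formula Agent
  | oughtS : Agent → Formula Agent → Formula Agent

/-- `◇φ := ¬□¬φ`. -/
def Formula.diam (φ : Formula Agent) : Formula Agent := .neg (.box (.neg φ))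

/-- Material implication `φ → ψ := ¬(φ ∧ ¬ψ)`. -/
def Formula.imp (φ ψ : Formula Agent) : Formula Agent := .neg (.conj φ (.neg ψ))

/-- Truth at an index of a (finite-choice) kiobt-model. -/
def truth (M : BiKiobtModel Agent Mom lt) : Formula Agent → Idx lt → Prop
  | .atom n, i => i ∈ M.val n
  | .neg φ, i => ¬ truth M φ i
  | .conj φ ψ, i => truth M φ i ∧ truth M ψ i
  | .box φ, i => ∀ (h' : Hist lt) (p : i.mom ∈ h'.val), truth M φ ⟨i.mom, h', p⟩
  | .stit a φ, i => ∀ L ∈ M.Choice a i.mom, i.hist ∈ L →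
      ∀ h' ∈ L, ∀ p : i.mom ∈ (h' : Hist lt).val, truth M φ ⟨i.mom, h', p⟩
  | .know a φ, i => ∀ j, M.epi a i j → truth M φ j
  | .intend a φ, i => ∃ U ∈ M.tau a i, U.Nonempty ∧ ∀ j ∈ U, truth M φ j
  | .oughtO a φ, i => ∀ L ∈ optimal M a i.mom, ∀ h' ∈ L,
      ∀ p : i.mom ∈ (h' : Hist lt).val, truth M φ ⟨i.mom, h', p⟩
  | .oughtS a φ, i => ∀ L ∈ soptimal M a i.mom, ∀ m', momRel M a i.mom m' →
      ∀ h' ∈ cluster M a i.mom L m', ∀ p : m' ∈ (h' : Hist lt).val, truth M φ ⟨m', h', p⟩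

/-- Purely propositional formulas, used to state the axiom schema of
propositional tautologies. -/
inductive PropForm : Type
  | var : ℕ → PropForm
  | neg : PropForm → PropForm
  | conj : PropForm → PropForm → PropForm

/-- Classical evaluation of a propositional form. -/
def PropForm.eval (v : ℕ → Prop) : PropForm → Prop
  | .var n => v n
  | .neg p => ¬ PropForm.eval v p
  | .conj p q => PropForm.eval v p ∧ PropForm.eval v q

/-- Substitute formulas for the variables of a propositional form. -/
def PropForm.toFormula (σ : ℕ → Formula Agent) : PropForm → Formula Agent
  | .var n => σ n
  | .neg p => .neg (PropForm.toFormula σ p)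
  | .conj p q => .conj (PropForm.toFormula σ p) (PropForm.toFormula σ q)

/-- `φ` is a substitution instance of a classical propositional tautology. -/
def Formula.isTautInstance (φ : Formula Agent) : Prop :=
  ∃ (p : PropForm) (σ : ℕ → Formula Agent),
    (∀ v : ℕ → Prop, PropForm.eval v p) ∧ φ = PropForm.toFormula σ p

/-- Uniform substitution of formulas for atomic propositions. -/
def Formula.subst (σ : ℕ → Formula Agent) : Formula Agent → Formula Agent
  | .atom n => σ n
  | .neg φ => .neg (Formula.subst σ φ)
  | .conj φ ψ => .conj (Formula.subst σ φ) (Formula.subst σ ψ)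
  | .box φ => .box (Formula.subst σ φ)
  | .stit a φ => .stit a (Formula.subst σ φ)
  | .know a φ => .know a (Formula.subst σ φ)
  | .intend a φ => .intend a (Formula.subst σ φ)
  | .oughtO a φ => .oughtO a (Formula.subst σ φ)
  | .oughtS a φ => .oughtS a (Formula.subst σ φ)

/-- Conjunction of a nonempty list of formulas (head and tail). -/
def bigConj : Formula Agent → List (Formula Agent) → Formula Agent
  | φ, [] => φ
  | φ, ψ :: l => .conj φ (bigConj ψ l)

/-- The proof system `Lambda_R'`. -/
inductive Lambda_R' {Agent : Type} : Formula Agent → Prop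
  /-- All classical propositional tautologies. -/
  | taut {φ : Formula Agent} : φ.isTautInstance → Lambda_R' φ
  /-- S5 for `□`: K. -/
  | boxK (φ ψ : Formula Agent) :
      Lambda_R' ((Formula.box (φ.imp ψ)).imp ((Formula.box φ).imp (Formula.box ψ)))
  /-- S5 for `□`: T. -/
  | boxT (φ : Formula Agent) : Lambda_R' ((Formula.box φ).imp φ)
  /-- S5 for `□`: 5. -/
  | box5 (φ : Formula Agent) :
      Lambda_R' ((Formula.diam φ).imp (Formula.box (Formula.diam φ)))
  /-- S5 for `[α]`: K. -/
  | stitK (a : Agent) (φ ψ : Formula Agent) :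
      Lambda_R' ((Formula.stit a (φ.imp ψ)).imp ((Formula.stit a φ).imp (Formula.stit a ψ)))
  /-- S5 for `[α]`: T. -/
  | stitT (a : Agent) (φ : Formula Agent) : Lambda_R' ((Formula.stit a φ).imp φ)
  /-- S5 for `[α]`: 5. -/
  | stit5 (a : Agent) (φ : Formula Agent) :
      Lambda_R' ((Formula.neg (Formula.stit a (Formula.neg φ))).imp
        (Formula.stit a (Formula.neg (Formula.stit a (Formula.neg φ)))))
  /-- S5 for `K_α`: K. -/
  | knowK (a : Agent) (φ ψ : Formula Agent) :
      Lambda_R' ((Formula.know a (φ.imp ψ)).imp ((Formula.know a φ).imp (Formula.know a ψ)))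
  /-- S5 for `K_α`: T. -/
  | knowT (a : Agent) (φ : Formula Agent) : Lambda_R' ((Formula.know a φ).imp φ)
  /-- S5 for `K_α`: 5. -/
  | know5 (a : Agent) (φ : Formula Agent) :
      Lambda_R' ((Formula.neg (Formula.know a (Formula.neg φ))).imp
        (Formula.know a (Formula.neg (Formula.know a (Formula.neg φ)))))
  /-- KD for `I_α`: K. -/
  | intK (a : Agent) (φ ψ : Formula Agent) :
      Lambda_R' ((Formula.intend a (φ.imp ψ)).imp
        ((Formula.intend a φ).imp (Formula.intend a ψ)))
  /-- KD for `I_α`: D. -/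
  | intD (a : Agent) (φ : Formula Agent) :
      Lambda_R' ((Formula.intend a φ).imp (Formula.neg (Formula.intend a (Formula.neg φ))))
  /-- (SET). -/
  | set (a : Agent) (φ : Formula Agent) : Lambda_R' ((Formula.box φ).imp (Formula.stit a φ))
  /-- (IA), for pairwise-distinct agents. -/
  | indep (p : Agent × Formula Agent) (l : List (Agent × Formula Agent))
      (hd : ((p :: l).map Prod.fst).Nodup) :
      Lambda_R' ((bigConj (Formula.diam (Formula.stit p.1 p.2))
          (l.map fun q => Formula.diam (Formula.stit q.1 q.2))).imp
        (Formula.diam (bigConj (Formula.stit p.1 p.2)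
          (l.map fun q => Formula.stit q.1 q.2))))
  /-- (OAC). -/
  | oac (a : Agent) (φ : Formula Agent) : Lambda_R' ((Formula.know a φ).imp (Formula.stit a φ))
  /-- (Unif-H). -/
  | unifH (a : Agent) (φ : Formula Agent) :
      Lambda_R' ((Formula.diam (Formula.know a φ)).imp (Formula.know a (Formula.diam φ)))
  /-- (A1). -/
  | a1 (a : Agent) (φ ψ : Formula Agent) :
      Lambda_R' ((Formula.oughtO a (φ.imp ψ)).imp
        ((Formula.oughtO a φ).imp (Formula.oughtO a ψ)))
  /-- (A2). -/
  | a2 (a : Agent) (φ : Formula Agent) : Lambda_R' ((Formula.box φ).imp (Formula.oughtO a φ))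
  /-- (A3). -/
  | a3 (a : Agent) (φ : Formula Agent) :
      Lambda_R' ((Formula.oughtO a φ).imp (Formula.box (Formula.oughtO a φ)))
  /-- (A4). -/
  | a4 (a : Agent) (φ : Formula Agent) :
      Lambda_R' ((Formula.oughtO a φ).imp (Formula.oughtO a (Formula.stit a φ)))
  /-- (Oic). -/
  | oic (a : Agent) (φ : Formula Agent) :
      Lambda_R' ((Formula.oughtO a φ).imp (Formula.diam (Formula.stit a φ)))
  /-- (A5). -/
  | a5 (a : Agent) (φ ψ : Formula Agent) :
      Lambda_R' ((Formula.oughtS a (φ.imp ψ)).imp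
        ((Formula.oughtS a φ).imp (Formula.oughtS a ψ)))
  /-- (A6). -/
  | a6 (a : Agent) (φ : Formula Agent) :
      Lambda_R' ((Formula.oughtS a φ).imp (Formula.oughtS a (Formula.know a φ)))
  /-- (SuN). -/
  | suN (a : Agent) (φ : Formula Agent) :
      Lambda_R' ((Formula.know a (Formula.box φ)).imp (Formula.oughtS a φ))
  /-- (s.Oic). -/
  | sOic (a : Agent) (φ : Formula Agent) :
      Lambda_R' ((Formula.oughtS a φ).imp (Formula.diam (Formula.know a φ)))
  /-- (s.Cl). -/
  | sCl (a : Agent) (φ : Formula Agent) :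
      Lambda_R' ((Formula.oughtS a φ).imp (Formula.know a (Formula.box (Formula.oughtS a φ))))
  /-- (InN). -/
  | inN (a : Agent) (φ : Formula Agent) :
      Lambda_R' ((Formula.box (Formula.know a φ)).imp (Formula.intend a φ))
  /-- (KI). -/
  | ki (a : Agent) (φ : Formula Agent) :
      Lambda_R' ((Formula.intend a φ).imp (Formula.box (Formula.know a (Formula.intend a φ))))
  /-- Modus ponens. -/
  | mp {φ ψ : Formula Agent} : Lambda_R' (φ.imp ψ) → Lambda_R' φ → Lambda_R' ψ
  /-- Uniform substitution. -/
  | subst {φ : Formula Agent} (σ : ℕ → Formula Agent) :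
      Lambda_R' φ → Lambda_R' (φ.subst σ)
  /-- Necessitation for `□`. -/
  | necBox {φ : Formula Agent} : Lambda_R' φ → Lambda_R' (Formula.box φ)
  /-- Necessitation for `[α]`. -/
  | necStit (a : Agent) {φ : Formula Agent} : Lambda_R' φ → Lambda_R' (Formula.stit a φ)
  /-- Necessitation for `K_α`. -/
  | necKnow (a : Agent) {φ : Formula Agent} : Lambda_R' φ → Lambda_R' (Formula.know a φ)
  /-- Necessitation for `I_α`. -/
  | necInt (a : Agent) {φ : Formula Agent} : Lambda_R' φ → Lambda_R' (Formula.intend a φ)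
  /-- Necessitation for `⊙_α`. -/
  | necOO (a : Agent) {φ : Formula Agent} : Lambda_R' φ → Lambda_R' (Formula.oughtO a φ)
  /-- Necessitation for `⊙^S_α`. -/
  | necOS (a : Agent) {φ : Formula Agent} : Lambda_R' φ → Lambda_R' (Formula.oughtS a φ)

/-! ### Derivability from a set of hypotheses -/

/-- A fixed contradiction. -/
def Formula.bot : Formula Agent := .conj (.atom 0) (.neg (.atom 0))

/-- Implication of propositional forms. -/
def PropForm.imp (p q : PropForm) : PropForm := .neg (.conj p (.neg q))

/-- The substitution sending the first variables to `φ`, `ψ` and all others to `χ`. -/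
def threeVars (φ ψ χ : Formula Agent) : ℕ → Formula Agent
  | 0 => φ
  | 1 => ψ
  | _ => χ

theorem Lambda_R'.of_propForm (p : PropForm) (φ ψ χ : Formula Agent) (h : ∀ v, p.eval v) :
    Lambda_R' (p.toFormula (threeVars φ ψ χ)) :=
  .taut ⟨p, _, h, rfl⟩

/-- Derivability from hypotheses, closing theorems and hypotheses under modus ponens only. -/
inductive Ded (Γ : Set (Formula Agent)) : Formula Agent → Prop
  | thm {φ : Formula Agent} : Lambda_R' φ → Ded Γ φ
  | hyp {φ : Formula Agent} : φ ∈ Γ → Ded Γ φ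
  | mp {φ ψ : Formula Agent} : Ded Γ (φ.imp ψ) → Ded Γ φ → Ded Γ ψ

section Propositional

variable (φ ψ χ : Formula Agent)

theorem taut_k : Lambda_R' (φ.imp (ψ.imp φ)) :=
  Lambda_R'.of_propForm (.imp (.var 0) (.imp (.var 1) (.var 0))) φ ψ ψ
    (by intro v; simp only [PropForm.imp, PropForm.eval]; tauto)

theorem taut_s : Lambda_R' ((φ.imp (ψ.imp χ)).imp ((φ.imp ψ).imp (φ.imp χ))) :=
  Lambda_R'.of_propForm (.imp (.imp (.var 0) (.imp (.var 1) (.var 2)))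
      (.imp (.imp (.var 0) (.var 1)) (.imp (.var 0) (.var 2)))) φ ψ χ
    (by intro v; simp only [PropForm.imp, PropForm.eval]; tauto)

theorem taut_neg_of_imp_bot : Lambda_R' ((φ.imp .bot).imp φ.neg) :=
  Lambda_R'.of_propForm (.imp (.imp (.var 0) (.conj (.var 1) (.neg (.var 1)))) (.neg (.var 0)))
    φ (.atom 0) φ (by intro v; simp only [PropForm.imp, PropForm.eval]; tauto)

theorem taut_of_neg_imp_bot : Lambda_R' ((φ.neg.imp .bot).imp φ) :=
  Lambda_R'.of_propForm (.imp (.imp (.neg (.var 0)) (.conj (.var 1) (.neg (.var 1)))) (.var 0))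
    φ (.atom 0) φ (by intro v; simp only [PropForm.imp, PropForm.eval]; tauto)

theorem taut_bot : Lambda_R' (φ.imp (φ.neg.imp .bot)) :=
  Lambda_R'.of_propForm
    (.imp (.var 0) (.imp (.neg (.var 0)) (.conj (.var 1) (.neg (.var 1)))))
    φ (.atom 0) φ (by intro v; simp only [PropForm.imp, PropForm.eval]; tauto)

theorem taut_conj : Lambda_R' (φ.imp (ψ.imp (.conj φ ψ))) :=
  Lambda_R'.of_propForm (.imp (.var 0) (.imp (.var 1) (.conj (.var 0) (.var 1)))) φ ψ ψ
    (by intro v; simp only [PropForm.imp, PropForm.eval]; tauto)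

theorem taut_left : Lambda_R' ((Formula.conj φ ψ).imp φ) :=
  Lambda_R'.of_propForm (.imp (.conj (.var 0) (.var 1)) (.var 0)) φ ψ ψ
    (by intro v; simp only [PropForm.imp, PropForm.eval]; tauto)

theorem taut_right : Lambda_R' ((Formula.conj φ ψ).imp ψ) :=
  Lambda_R'.of_propForm (.imp (.conj (.var 0) (.var 1)) (.var 1)) φ ψ ψ
    (by intro v; simp only [PropForm.imp, PropForm.eval]; tauto)

theorem taut_refl : Lambda_R' (φ.imp φ) :=
  Lambda_R'.of_propForm (.imp (.var 0) (.var 0)) φ φ φ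
    (by intro v; simp only [PropForm.imp, PropForm.eval]; tauto)

end Propositional

section Derivability

variable {Γ Δ : Set (Formula Agent)} {φ ψ : Formula Agent}

theorem Ded.deduction (h : Ded (insert φ Γ) ψ) : Ded Γ (φ.imp ψ) := by
  induction h with
  | thm h => exact .mp (.thm (taut_k _ φ)) (.thm h)
  | hyp h =>
    rcases h with rfl | h
    · exact .thm (taut_refl _)
    · exact .mp (.thm (taut_k _ φ)) (.hyp h)
  | mp _ _ h₁ h₂ => exact .mp (.mp (.thm (taut_s _ _ _)) h₁) h₂

theorem Ded.cut (h : Ded Γ φ) (hΓ : ∀ ψ ∈ Γ, Ded Δ ψ) : Ded Δ φ := by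
  induction h with
  | thm h => exact .thm h
  | hyp h => exact hΓ _ h
  | mp _ _ h₁ h₂ => exact .mp h₁ h₂

theorem Ded.mono (h : Ded Γ φ) (hΓ : Γ ⊆ Δ) : Ded Δ φ :=
  h.cut fun _ hψ => .hyp (hΓ hψ)

theorem Ded.bot_of_neg (h₁ : Ded Γ φ) (h₂ : Ded Γ φ.neg) : Ded Γ .bot :=
  .mp (.mp (.thm (taut_bot φ)) h₁) h₂

theorem Ded.of_insert_neg (h : Ded (insert φ.neg Γ) .bot) : Ded Γ φ :=
  .mp (.thm (taut_of_neg_imp_bot φ)) h.deduction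

theorem Ded.neg_of_insert (h : Ded (insert φ Γ) .bot) : Ded Γ φ.neg :=
  .mp (.thm (taut_neg_of_imp_bot φ)) h.deduction

theorem Ded.conj (h₁ : Ded Γ φ) (h₂ : Ded Γ ψ) : Ded Γ (.conj φ ψ) :=
  .mp (.mp (.thm (taut_conj φ ψ)) h₁) h₂

theorem Ded.left (h : Ded Γ (.conj φ ψ)) : Ded Γ φ := .mp (.thm (taut_left φ ψ)) h

theorem Ded.right (h : Ded Γ (.conj φ ψ)) : Ded Γ ψ := .mp (.thm (taut_right φ ψ)) h

theorem Ded.lambda (h : Ded ∅ φ) : Lambda_R' φ := by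
  induction h with
  | thm h => exact h
  | hyp h => exact h.elim
  | mp _ _ h₁ h₂ => exact .mp h₁ h₂

theorem Ded.bigConj_mem {l : List (Formula Agent)} :
    Ded Γ (bigConj φ l) → ∀ ψ ∈ φ :: l, Ded Γ ψ := by
  induction l generalizing φ with
  | nil => intro h ψ hψ; simp only [List.mem_singleton] at hψ; exact hψ ▸ h
  | cons χ l ih =>
    intro h ψ hψ
    rcases List.mem_cons.1 hψ with rfl | hψ
    · exact Ded.left h
    · exact ih (Ded.right h) ψ hψ

theorem Ded.bigConj {l : List (Formula Agent)} :
    (∀ ψ ∈ φ :: l, Ded Γ ψ) → Ded Γ (bigConj φ l) := by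
  induction l generalizing φ with
  | nil => intro h; exact h φ (by simp)
  | cons χ l ih =>
    intro h
    exact Ded.conj (h φ (by simp)) (ih fun ψ hψ => h ψ (List.mem_cons_of_mem _ hψ))

theorem Ded.exists_mem_of_chain {c : Set (Set (Formula Agent))} (hc : IsChain (· ⊆ ·) c)
    (hne : c.Nonempty) (h : Ded (⋃₀ c) φ) : ∃ Γ ∈ c, Ded Γ φ := by
  induction h with
  | thm h => obtain ⟨Γ, hΓ⟩ := hne; exact ⟨Γ, hΓ, .thm h⟩
  | hyp h => obtain ⟨Γ, hΓ, h⟩ := h; exact ⟨Γ, hΓ, .hyp h⟩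
  | mp _ _ h₁ h₂ =>
    obtain ⟨Γ, hΓ, h₁⟩ := h₁
    obtain ⟨Δ, hΔ, h₂⟩ := h₂
    rcases hc.total hΓ hΔ with h | h
    · exact ⟨Δ, hΔ, .mp (h₁.mono h) h₂⟩
    · exact ⟨Γ, hΓ, .mp h₁ (h₂.mono h)⟩

/-- A derivation from a family of deductively closed sets uses just one formula of each. -/
theorem Ded.interpolate {ι : Type} {A : Set (Formula Agent)} {C : ι → Set (Formula Agent)}
    (hC : ∀ i ψ, Ded (C i) ψ → ψ ∈ C i) (h : Ded (A ∪ ⋃ i, C i) φ) :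
    ∃ f : ι → Formula Agent, (∀ i, f i ∈ C i) ∧ Ded (A ∪ Set.range f) φ := by
  classical
  have htop (i : ι) : (Formula.bot.imp .bot : Formula Agent) ∈ C i :=
    hC i _ (.thm (taut_refl _))
  induction h with
  | thm h => exact ⟨fun _ => Formula.bot.imp .bot, htop, .thm h⟩
  | @hyp ψ h =>
    rcases h with h | h
    · exact ⟨fun _ => Formula.bot.imp .bot, htop, .hyp (.inl h)⟩
    · obtain ⟨i, hi⟩ := Set.mem_iUnion.1 h
      refine ⟨fun j => if j = i then ψ else Formula.bot.imp .bot, fun j => ?_, .hyp (.inr ⟨i, ?_⟩)⟩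
      · dsimp only
        split_ifs with hj
        · exact hj ▸ hi
        · exact htop j
      · simp
  | mp _ _ h₁ h₂ =>
    obtain ⟨f, hf, h₁⟩ := h₁
    obtain ⟨g, hg, h₂⟩ := h₂
    have key (i : ι) : Ded (A ∪ Set.range fun i => Formula.conj (f i) (g i)) (.conj (f i) (g i)) :=
      .hyp (.inr ⟨i, rfl⟩)
    refine ⟨fun i => .conj (f i) (g i), fun i => hC i _ ((Ded.hyp (hf i)).conj (.hyp (hg i))),
      .mp (h₁.cut ?_) (h₂.cut ?_)⟩
    · rintro χ (hχ | ⟨i, rfl⟩)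
      · exact .hyp (.inl hχ)
      · exact (key i).left
    · rintro χ (hχ | ⟨i, rfl⟩)
      · exact .hyp (.inl hχ)
      · exact (key i).right

end Derivability

/-! ### Maximal consistent sets -/

/-- Maximal consistent sets of formulas. -/
structure MCS (Γ : Set (Formula Agent)) : Prop where
  cons : ¬ Ded Γ .bot
  max : ∀ φ, φ ∈ Γ ∨ φ.neg ∈ Γ

/-- Worlds of the canonical model. -/
abbrev World (Agent : Type) : Type := {Γ : Set (Formula Agent) // MCS Γ}

theorem exists_world {Γ : Set (Formula Agent)} (h : ¬ Ded Γ .bot) :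
    ∃ w : World Agent, Γ ⊆ w.1 := by
  obtain ⟨Δ, hΓΔ, hΔ⟩ := zorn_subset_nonempty {Γ : Set (Formula Agent) | ¬ Ded Γ .bot}
    (fun c hcS hc hne => ⟨⋃₀ c, fun hbot => by
      obtain ⟨Γ, hΓ, hd⟩ := Ded.exists_mem_of_chain hc hne hbot
      exact hcS hΓ hd, fun _ => Set.subset_sUnion_of_mem⟩) Γ h
  have hmem {φ : Formula Agent} (hφ : ¬ Ded (insert φ Δ) .bot) : φ ∈ Δ :=
    hΔ.2 hφ (Set.subset_insert _ _) (Set.mem_insert _ _)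
  refine ⟨⟨Δ, hΔ.1, fun φ => ?_⟩, hΓΔ⟩
  by_contra! hφ
  have h₁ : Ded (insert φ Δ) .bot := by by_contra h; exact hφ.1 (hmem h)
  have h₂ : Ded (insert φ.neg Δ) .bot := by by_contra h; exact hφ.2 (hmem h)
  exact hΔ.1 (h₂.of_insert_neg.bot_of_neg h₁.neg_of_insert)

section World

variable {w v u : World Agent} {φ ψ : Formula Agent}

theorem mem_of_ded (h : Ded w.1 φ) : φ ∈ w.1 :=
  (w.2.max φ).resolve_right fun hn => w.2.cons (h.bot_of_neg (.hyp hn))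

theorem mem_of_thm (h : Lambda_R' φ) : φ ∈ w.1 := mem_of_ded (.thm h)

theorem mem_neg : φ.neg ∈ w.1 ↔ φ ∉ w.1 :=
  ⟨fun h h' => w.2.cons ((Ded.hyp h').bot_of_neg (.hyp h)), (w.2.max φ).resolve_left⟩

theorem mem_conj : Formula.conj φ ψ ∈ w.1 ↔ φ ∈ w.1 ∧ ψ ∈ w.1 :=
  ⟨fun h => ⟨mem_of_ded (Ded.hyp h).left, mem_of_ded (Ded.hyp h).right⟩,
    fun h => mem_of_ded ((Ded.hyp h.1).conj (.hyp h.2))⟩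

theorem mem_imp : φ.imp ψ ∈ w.1 ↔ (φ ∈ w.1 → ψ ∈ w.1) := by
  simp only [Formula.imp, mem_neg, mem_conj]; tauto

theorem mem_diam : φ.diam ∈ w.1 ↔ φ.neg.box ∉ w.1 := mem_neg

theorem bot_notMem : Formula.bot ∉ w.1 := fun h => w.2.cons (.hyp h)

theorem mem_of_imp (h : Lambda_R' (φ.imp ψ)) (hφ : φ ∈ w.1) : ψ ∈ w.1 :=
  mem_imp.1 (mem_of_thm h) hφ

theorem Lambda_R'.of_forall_mem (h : ∀ w : World Agent, φ ∈ w.1) : Lambda_R' φ := by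
  by_contra hφ
  obtain ⟨w, hw⟩ := exists_world (Γ := insert φ.neg ∅) fun hb => hφ hb.of_insert_neg.lambda
  exact mem_neg.1 (hw (Set.mem_insert _ _)) (h w)

/-! ### Normal and S5 operators -/

/-- Operators with distribution over implication and necessitation. -/
structure Normal (f : Formula Agent → Formula Agent) : Prop where
  dist : ∀ φ ψ : Formula Agent, Lambda_R' ((f (φ.imp ψ)).imp ((f φ).imp (f ψ)))
  nec : ∀ {φ : Formula Agent}, Lambda_R' φ → Lambda_R' (f φ)

/-- Operators satisfying the S5 schemata. -/
structure S5 (f : Formula Agent → Formula Agent) : Prop extends Normal f where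
  refl : ∀ φ : Formula Agent, Lambda_R' ((f φ).imp φ)
  eucl : ∀ φ : Formula Agent, Lambda_R' ((f φ.neg).neg.imp (f (f φ.neg).neg))

/-- The canonical accessibility relation of an S5 operator. -/
def acc (f : Formula Agent → Formula Agent) : Setoid (World Agent) where
  r w v := ∀ ψ, f ψ ∈ w.1 ↔ f ψ ∈ v.1
  iseqv := ⟨fun _ _ => .rfl, fun h ψ => (h ψ).symm, fun h h' ψ => (h ψ).trans (h' ψ)⟩

variable {f g : Formula Agent → Formula Agent}

theorem Normal.ded (hf : Normal f) {Γ : Set (Formula Agent)} (h : Ded {ψ | f ψ ∈ Γ} φ) :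
    Ded Γ (f φ) := by
  induction h with
  | thm h => exact .thm (hf.nec h)
  | hyp h => exact .hyp h
  | mp _ _ h₁ h₂ => exact .mp (.mp (.thm (hf.dist _ _)) h₁) h₂

theorem Normal.mem_of_ded (hf : Normal f) (h : Ded {ψ | f ψ ∈ w.1} φ) : f φ ∈ w.1 :=
  IEAUST.mem_of_ded (hf.ded h)

theorem Normal.mono (hf : Normal f) (h : Lambda_R' (φ.imp ψ)) (hφ : f φ ∈ w.1) : f ψ ∈ w.1 :=
  mem_imp.1 (mem_of_imp (hf.dist φ ψ) (mem_of_thm (hf.nec h))) hφ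

theorem Normal.exists_notMem (hf : Normal f) (h : f φ ∉ w.1) :
    ∃ v : World Agent, (∀ ψ, f ψ ∈ w.1 → ψ ∈ v.1) ∧ φ ∉ v.1 := by
  obtain ⟨v, hv⟩ := exists_world (Γ := insert φ.neg {ψ | f ψ ∈ w.1})
    fun hb => h (hf.mem_of_ded hb.of_insert_neg)
  exact ⟨v, fun ψ hψ => hv (Set.mem_insert_of_mem _ hψ), mem_neg.1 (hv (Set.mem_insert _ _))⟩

theorem S5.neg_introspection (hf : S5 f) (h : f φ ∉ w.1) : f (f φ).neg ∈ w.1 := by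
  have hnn : Lambda_R' (φ.imp φ.neg.neg) :=
    .of_forall_mem fun w => by simp only [mem_imp, mem_neg, not_not, imp_self]
  have hnn' : Lambda_R' (φ.neg.neg.imp φ) :=
    .of_forall_mem fun w => by simp only [mem_imp, mem_neg, not_not, imp_self]
  have h₁ : f φ.neg.neg ∉ w.1 := fun h' => h (hf.toNormal.mono hnn' h')
  refine hf.toNormal.mono (.of_forall_mem fun v => ?_)
    (mem_of_imp (hf.eucl φ.neg) (mem_neg.2 h₁))
  simp only [mem_imp, mem_neg]
  exact mt (hf.toNormal.mono hnn)

theorem S5.acc_of_forall (hf : S5 f) (h : ∀ ψ, f ψ ∈ w.1 → ψ ∈ v.1) : acc f w v := by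
  have back {w v : World Agent} (h : ∀ ψ, f ψ ∈ w.1 → ψ ∈ v.1) {ψ : Formula Agent}
      (hψ : f ψ ∈ v.1) : f ψ ∈ w.1 := by
    by_contra hn
    exact mem_neg.1 (h _ (hf.neg_introspection hn)) hψ
  exact fun ψ => ⟨back fun χ hχ => mem_of_imp (hf.refl χ) (back h hχ), back h⟩

theorem S5.mem_of_acc (hf : S5 f) (h : acc f w v) (hφ : f φ ∈ w.1) : φ ∈ v.1 :=
  mem_of_imp (hf.refl φ) ((h φ).1 hφ)

theorem S5.mem_iff (hf : S5 f) : f φ ∈ w.1 ↔ ∀ v, acc f w v → φ ∈ v.1 := by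
  refine ⟨fun h v hv => hf.mem_of_acc hv h, fun h => ?_⟩
  by_contra hn
  obtain ⟨v, hv, hφ⟩ := hf.toNormal.exists_notMem hn
  exact hφ (h v (hf.acc_of_forall hv))

theorem S5.acc_of_acc (hf : S5 f) (hg : S5 g) (hfg : ∀ φ, Lambda_R' ((f φ).imp (g φ)))
    (h : acc g w v) : acc f w v :=
  hf.acc_of_forall fun ψ hψ => hg.mem_of_acc h (mem_of_imp (hfg ψ) hψ)

/-- Worlds containing everything that a normal operator prescribes. -/
def ideal (g : Formula Agent → Formula Agent) : Set (World Agent) :=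
  {v | ∀ ψ, g ψ ∈ v.1 → ψ ∈ v.1}

theorem Normal.mem_iff_ideal (hg : Normal g) {R : Setoid (World Agent)}
    (hconst : ∀ {w v}, R w v → ∀ ψ, g ψ ∈ w.1 → g ψ ∈ v.1)
    (hsub : ∀ {w v}, (∀ ψ, g ψ ∈ w.1 → ψ ∈ v.1) → R w v) :
    g φ ∈ w.1 ↔ ∀ v ∈ ideal g, R w v → φ ∈ v.1 := by
  refine ⟨fun h v hv hR => hv _ (hconst hR _ h), fun h => ?_⟩
  by_contra hn
  obtain ⟨v, hv, hφ⟩ := hg.exists_notMem hn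
  exact hφ (h v (fun ψ hψ => hv ψ (hconst (R.symm (hsub hv)) ψ hψ)) (hsub hv))

theorem Normal.exists_ideal (hg : Normal g) {R : Setoid (World Agent)}
    (hconst : ∀ {w v}, R w v → ∀ ψ, g ψ ∈ w.1 → g ψ ∈ v.1)
    (hsub : ∀ {w v}, (∀ ψ, g ψ ∈ w.1 → ψ ∈ v.1) → R w v)
    (hbot : g .bot ∉ w.1) : ∃ v ∈ ideal g, R w v := by
  by_contra! h
  exact hbot ((hg.mem_iff_ideal hconst hsub).2 fun v hv hR => (h v hv hR).elim)

/-! ### The canonical frame -/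

theorem s5_box : S5 (Formula.box : Formula Agent → Formula Agent) :=
  ⟨⟨.boxK, .necBox⟩, .boxT, .box5⟩

theorem s5_stit (a : Agent) : S5 (Formula.stit a) := ⟨⟨.stitK a, .necStit a⟩, .stitT a, .stit5 a⟩

theorem s5_know (a : Agent) : S5 (Formula.know a) := ⟨⟨.knowK a, .necKnow a⟩, .knowT a, .know5 a⟩

theorem normal_intend (a : Agent) : Normal (Formula.intend a) := ⟨.intK a, .necInt a⟩

theorem normal_oughtO (a : Agent) : Normal (Formula.oughtO a) := ⟨.a1 a, .necOO a⟩

theorem normal_oughtS (a : Agent) : Normal (Formula.oughtS a) := ⟨.a5 a, .necOS a⟩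

theorem acc_box_of_stit {a : Agent} (h : acc (.stit a) w v) : acc .box w v :=
  s5_box.acc_of_acc (s5_stit a) (.set a) h

theorem acc_know_of_stit {a : Agent} (h : acc (.stit a) w v) : acc (.know a) w v :=
  (s5_know a).acc_of_acc (s5_stit a) (.oac a) h

/-- If no formula boxed by `g` at `v` is refuted by a formula boxed by `f` at `w`, then `w` and
`v` have a common successor. -/
theorem S5.exists_common (hf : S5 f) (hg : S5 g)
    (h : ∀ χ, g χ ∈ v.1 → f χ.neg ∉ w.1) : ∃ u, acc f w u ∧ acc g v u := by
  obtain ⟨u, hu⟩ := exists_world (Γ := {ψ | f ψ ∈ w.1} ∪ ⋃ _ : Unit, {ψ | g ψ ∈ v.1}) fun hb => by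
    obtain ⟨k, hk, hb⟩ := Ded.interpolate (fun _ ψ hψ => hg.toNormal.mem_of_ded hψ) hb
    refine h (k ()) (hk ()) (hf.toNormal.mem_of_ded (Ded.neg_of_insert (hb.mono ?_)))
    rintro χ (hχ | ⟨⟨⟩, rfl⟩)
    · exact .inr hχ
    · exact .inl rfl
  exact ⟨u, hf.acc_of_forall fun ψ hψ => hu (.inl hψ),
    hg.acc_of_forall fun ψ hψ => hu (.inr (Set.mem_iUnion.2 ⟨(), hψ⟩))⟩

theorem acc_unifH {a : Agent} {w' : World Agent} (h : acc (.know a) w v) (h' : acc .box w w') :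
    ∃ v', acc .box v v' ∧ acc (.know a) w' v' := by
  refine s5_box.exists_common (s5_know a) fun χ hχ hn => ?_
  have h₁ : (Formula.know a χ).diam ∈ w.1 :=
    mem_diam.2 fun hb => mem_neg.1 (s5_box.mem_of_acc h' hb) hχ
  exact mem_diam.1 ((s5_know a).mem_of_acc h (mem_of_imp (.unifH a χ) h₁)) hn

/-- The canonical relation of belonging to the same ex ante information set. -/
def info (a : Agent) : Setoid (World Agent) where
  r w v := ∃ u, acc (.know a) w u ∧ acc .box u v
  iseqv := by
    refine ⟨fun w => ⟨w, Setoid.refl' _ _, Setoid.refl' _ _⟩, ?_, ?_⟩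
    · rintro w v ⟨u, h₁, h₂⟩
      obtain ⟨v', h₃, h₄⟩ := acc_unifH (Setoid.symm' _ h₁) h₂
      exact ⟨v', h₄, Setoid.symm' _ h₃⟩
    · rintro w v y ⟨u, h₁, h₂⟩ ⟨x, h₃, h₄⟩
      obtain ⟨z, h₅, h₆⟩ := acc_unifH h₃ (Setoid.symm' _ h₂)
      exact ⟨z, Setoid.trans' _ h₁ h₆, Setoid.trans' _ (Setoid.symm' _ h₅) h₄⟩

theorem info_of_box {a : Agent} (h : acc .box w v) : info a w v := ⟨w, Setoid.refl' _ _, h⟩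

theorem info_of_know {a : Agent} (h : acc (.know a) w v) : info a w v := ⟨v, h, Setoid.refl' _ _⟩

theorem exists_box_know {a : Agent} (h : info a w v) :
    ∃ u, acc .box w u ∧ acc (.know a) u v := by
  obtain ⟨u, h₁, h₂⟩ := (info a).symm h
  exact ⟨u, Setoid.symm' _ h₂, Setoid.symm' _ h₁⟩

theorem info_of_forall_know_box {a : Agent}
    (h : ∀ ψ : Formula Agent, ψ.box.know a ∈ w.1 → ψ ∈ v.1) :
    info a w v := by
  obtain ⟨u, h₁, h₂⟩ := (s5_know a).exists_common s5_box (w := w) (v := v) fun χ hχ hn => by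
    refine mem_neg.1 (h (Formula.box χ).neg
      ((s5_know a).toNormal.mono (.of_forall_mem fun x => ?_) hn)) hχ
    simp only [mem_imp, mem_neg]
    exact fun hx => s5_box.neg_introspection fun hb => hx (mem_of_imp (.boxT χ) hb)
  exact ⟨u, h₁, Setoid.symm' _ h₂⟩

theorem mem_of_info {a : Agent} (h : info a w v) (hφ : φ.box.know a ∈ w.1) : φ ∈ v.1 := by
  obtain ⟨u, h₁, h₂⟩ := h
  exact s5_box.mem_of_acc h₂ ((s5_know a).mem_of_acc h₁ hφ)

theorem mem_of_info' {a : Agent} (h : info a w v) (hφ : (φ.know a).box ∈ w.1) : φ ∈ v.1 := by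
  obtain ⟨u, h₁, h₂⟩ := exists_box_know h
  exact (s5_know a).mem_of_acc h₂ (s5_box.mem_of_acc h₁ hφ)

theorem info_of_forall_box_know {a : Agent}
    (h : ∀ ψ : Formula Agent, (ψ.know a).box ∈ w.1 → ψ ∈ v.1) :
    info a w v :=
  info_of_forall_know_box fun ψ hψ => h ψ <| s5_box.mem_iff.2 fun _ hu =>
    (s5_know a).mem_iff.2 fun _ hx =>
      mem_of_info ((info a).trans (info_of_box hu) (info_of_know hx)) hψ

theorem acc_independence [Finite Agent] (ws : Agent → World Agent)
    (h : ∀ a, acc .box w (ws a)) : ∃ v, ∀ a, acc (.stit a) (ws a) v := by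
  classical
  have := Fintype.ofFinite Agent
  suffices hcon : ¬ Ded ({ψ | ψ.box ∈ w.1} ∪ ⋃ a, {ψ | ψ.stit a ∈ (ws a).1}) .bot by
    obtain ⟨v, hv⟩ := exists_world hcon
    exact ⟨v, fun a => (s5_stit a).acc_of_forall fun ψ hψ => hv (.inr (Set.mem_iUnion.2 ⟨a, hψ⟩))⟩
  intro hb
  obtain ⟨k, hk, hb⟩ := Ded.interpolate (C := fun a => {ψ | ψ.stit a ∈ (ws a).1})
    (fun a ψ hψ => (s5_stit a).toNormal.mem_of_ded hψ) hb
  have hd (a : Agent) : ((k a).stit a).diam ∈ w.1 :=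
    mem_diam.2 fun hn => mem_neg.1 (s5_box.mem_of_acc (h a) hn) (hk a)
  have hmem (a : Agent) : a ∈ (Finset.univ : Finset Agent).toList := by simp
  have hnd : (Finset.univ : Finset Agent).toList.Nodup := Finset.nodup_toList _
  generalize (Finset.univ : Finset Agent).toList = l at hmem hnd
  cases l with
  | nil =>
    refine bot_notMem (mem_of_imp (w := w) (.boxT .bot) (s5_box.toNormal.mem_of_ded (hb.mono ?_)))
    rintro χ (hχ | ⟨a, rfl⟩)
    · exact hχ
    · exact absurd (hmem a) (by simp)
  | cons a l =>
    have hax := Lambda_R'.indep (a, k a) (l.map fun b => (b, k b))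
      (by simpa [Function.comp_def] using hnd)
    simp only [List.map_map, Function.comp_def] at hax
    have h₁ := mem_of_imp (w := w) hax (mem_of_ded (Ded.bigConj fun ψ hψ => by
      rcases List.mem_cons.1 hψ with rfl | hψ
      · exact .hyp (hd a)
      · obtain ⟨b, -, rfl⟩ := List.mem_map.1 hψ
        exact .hyp (hd b)))
    refine mem_diam.1 h₁ (s5_box.toNormal.mem_of_ded (Ded.neg_of_insert (hb.cut ?_)))
    rintro χ (hχ | ⟨b, rfl⟩)
    · exact .hyp (.inr hχ)
    · refine .mp (.thm (.stitT b _)) (Ded.bigConj_mem (.hyp (.inl rfl)) _ ?_)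
      rcases List.mem_cons.1 (hmem b) with rfl | hb
      · exact List.mem_cons_self
      · exact List.mem_cons_of_mem _ (List.mem_map.2 ⟨b, hb, rfl⟩)

end World

/-! ### Relational frames -/

/-- Relational structures for the language: `box`, `stit` and `know` interpret the S5 operators,
the sets of worlds `bestO`, `bestS` and `core` the two ought operators and the intentions. -/
structure Frame (Agent : Type) where
  World : Type
  nonempty : Nonempty World
  box : Setoid World
  stit : Agent → Setoid World
  know : Agent → Setoid World
  box_of_stit : ∀ {a w v}, stit a w v → box w v
  know_of_stit : ∀ {a w v}, stit a w v → know a w v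
  unifH : ∀ {a w v w'}, know a w v → box w w' → ∃ v', box v v' ∧ know a w' v'
  indep : ∀ (w : World) (ws : Agent → World), (∀ a, box w (ws a)) → ∃ v, ∀ a, stit a (ws a) v
  fin_choice : ∀ a, ∃ (ι : Type) (_ : Finite ι) (c : World → ι),
    ∀ w v, box w v → c w = c v → stit a w v
  bestO : Agent → Set World
  bestO_stit : ∀ {a w v}, stit a w v → w ∈ bestO a → v ∈ bestO a
  exists_bestO : ∀ a w, ∃ v ∈ bestO a, box w v
  bestS : Agent → Set World
  bestS_know : ∀ {a w v}, know a w v → w ∈ bestS a → v ∈ bestS a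
  exists_bestS : ∀ a w, ∃ v ∈ bestS a, box w v
  core : Agent → Set World
  exists_core : ∀ a w, ∃ v ∈ core a, ∃ u, box w u ∧ know a u v
  val : ℕ → Set World

attribute [instance] Frame.nonempty

namespace Frame

/-- Belonging to the same ex ante information set. -/
def info (F : Frame Agent) (a : Agent) (w v : F.World) : Prop := ∃ u, F.box w u ∧ F.know a u v

/-- Truth at a world of a relational frame. -/
def sat (F : Frame Agent) : Formula Agent → F.World → Prop
  | .atom n, w => w ∈ F.val n
  | .neg φ, w => ¬ F.sat φ w
  | .conj φ ψ, w => F.sat φ w ∧ F.sat ψ w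
  | .box φ, w => ∀ v, F.box w v → F.sat φ v
  | .stit a φ, w => ∀ v, F.stit a w v → F.sat φ v
  | .know a φ, w => ∀ v, F.know a w v → F.sat φ v
  | .intend a φ, w => ∀ v ∈ F.core a, F.info a w v → F.sat φ v
  | .oughtO a φ, w => ∀ v ∈ F.bestO a, F.box w v → F.sat φ v
  | .oughtS a φ, w => ∀ v ∈ F.bestS a, F.info a w v → F.sat φ v

section BranchingTime

variable (F : Frame Agent)

/-- Moments: the `box`-classes, each followed by its worlds as final moments. -/
abbrev Moment : Type := Quotient F.box ⊕ F.World

/-- A `box`-class precedes exactly its members. -/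
def before : F.Moment → F.Moment → Prop
  | .inl q, .inr w => q = Quotient.mk F.box w
  | _, _ => False

/-- The moments on the history determined by a world. -/
def histSet (w : F.World) : Set F.Moment := {.inl (Quotient.mk F.box w), .inr w}

theorem isChain_histSet (w : F.World) : IsChain F.before (F.histSet w) := by
  rintro x (rfl | rfl) y (rfl | rfl) hne
  · exact absurd rfl hne
  · exact .inl rfl
  · exact .inr rfl
  · exact absurd rfl hne

variable {F}

theorem subset_histSet {s : Set F.Moment} (hs : IsChain F.before s) {w : F.World}
    (hw : Sum.inr w ∈ s) : s ⊆ F.histSet w := by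
  rintro (q | v) hx
  · rcases hs hx hw (by simp) with h | h
    · exact .inl (congrArg Sum.inl h)
    · exact h.elim
  · by_cases hv : v = w
    · exact .inr (congrArg Sum.inr hv)
    · exact (hs hx hw (by simpa using hv)).elim False.elim False.elim

theorem isMaxChain_histSet (w : F.World) : IsMaxChain F.before (F.histSet w) :=
  ⟨F.isChain_histSet w, fun _ ht hst => hst.antisymm (subset_histSet ht (hst (.inr rfl)))⟩

theorem exists_eq_histSet {s : Set F.Moment} (hs : IsMaxChain F.before s) :
    ∃ w, s = F.histSet w := by
  by_cases h : ∃ w, Sum.inr w ∈ s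
  · obtain ⟨w, hw⟩ := h
    exact ⟨w, hs.2 (F.isChain_histSet w) (subset_histSet hs.1 hw)⟩
  · suffices ∃ w, s ⊆ F.histSet w by
      obtain ⟨w, hw⟩ := this
      exact ⟨w, hs.2 (F.isChain_histSet w) hw⟩
    by_cases hq : ∃ q, Sum.inl q ∈ s
    · obtain ⟨q, hq⟩ := hq
      obtain ⟨w, rfl⟩ := Quotient.exists_rep q
      refine ⟨w, ?_⟩
      rintro (q' | v) hx
      · by_cases hqq : q' = Quotient.mk F.box w
        · exact .inl (congrArg Sum.inl hqq)
        · exact (hs.1 hx hq (by simpa using hqq)).elim False.elim False.elim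
      · exact absurd ⟨v, hx⟩ h
    · refine ⟨Classical.arbitrary _, ?_⟩
      rintro (q | v) hx
      · exact absurd ⟨q, hx⟩ hq
      · exact absurd ⟨v, hx⟩ h

/-- The history determined by a world. -/
def hist (w : F.World) : Hist F.before := ⟨F.histSet w, isMaxChain_histSet w⟩

theorem exists_hist_eq (h : Hist F.before) : ∃ w : F.World, hist w = h := by
  obtain ⟨w, hw⟩ := exists_eq_histSet h.2
  exact ⟨w, Subtype.ext hw.symm⟩

/-- The world determining a history. -/
noncomputable def worldOf (h : Hist F.before) : F.World := (exists_hist_eq h).choose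

theorem hist_worldOf (h : Hist F.before) : hist (worldOf h) = h := (exists_hist_eq h).choose_spec

theorem mem_hist {m : F.Moment} {w : F.World} :
    m ∈ (hist w).val ↔ m = .inl (Quotient.mk F.box w) ∨ m = .inr w := Iff.rfl

@[simp] theorem worldOf_hist (w : F.World) : worldOf (hist w) = w := by
  have h : Sum.inr (worldOf (hist w)) ∈ (hist (worldOf (hist w))).val := .inr rfl
  rw [hist_worldOf (hist w)] at h
  simpa using mem_hist.1 h

theorem mem_iff_worldOf {m : F.Moment} {h : Hist F.before} :
    m ∈ h.val ↔ m = .inl (Quotient.mk F.box (worldOf h)) ∨ m = .inr (worldOf h) := by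
  conv_lhs => rw [← hist_worldOf h]
  exact mem_hist

theorem mem_mk (w : F.World) : Sum.inl (Quotient.mk F.box w) ∈ (hist w).val := .inl rfl

theorem box_of_mem {m : F.Moment} (hm : m.isLeft) {h h' : Hist F.before} (hh : m ∈ h.val)
    (hh' : m ∈ h'.val) : F.box (worldOf h) (worldOf h') := by
  rcases mem_iff_worldOf.1 hh with rfl | rfl
  · rcases mem_iff_worldOf.1 hh' with hh' | hh'
    · exact Quotient.exact (Sum.inl.inj hh')
    · cases hh'
  · cases hm

theorem eq_of_mem {m : F.Moment} (hm : ¬ m.isLeft) {h h' : Hist F.before} (hh : m ∈ h.val)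
    (hh' : m ∈ h'.val) : h = h' := by
  rcases mem_iff_worldOf.1 hh with rfl | rfl
  · exact absurd rfl hm
  · rcases mem_iff_worldOf.1 hh' with hh' | hh'
    · cases hh'
    · rw [← hist_worldOf h, Sum.inr.inj hh', hist_worldOf]

theorem mem_of_box {m : F.Moment} (hm : m.isLeft) {h : Hist F.before} (hh : m ∈ h.val)
    {w : F.World} (hw : F.box (worldOf h) w) : m ∈ (hist w).val := by
  rcases mem_iff_worldOf.1 hh with rfl | rfl
  · exact .inl (congrArg Sum.inl (Quotient.sound hw))
  · cases hm

theorem exists_mem (m : F.Moment) : ∃ h : Hist F.before, m ∈ h.val := by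
  rcases m with q | w
  · obtain ⟨w, rfl⟩ := Quotient.exists_rep q
    exact ⟨hist w, mem_mk w⟩
  · exact ⟨hist w, .inr rfl⟩

/-- The choice cell of a world at a moment. -/
def cell (a : Agent) (m : F.Moment) (w : F.World) : Set (Hist F.before) :=
  {h | m ∈ h.val ∧ (m.isLeft → F.stit a w (worldOf h))}

theorem mem_cell_self {a : Agent} {m : F.Moment} {h : Hist F.before} (hh : m ∈ h.val) :
    h ∈ cell a m (worldOf h) := ⟨hh, fun _ => Setoid.refl' _ _⟩

theorem cell_congr {a : Agent} {m : F.Moment} {w v : F.World} (h : m.isLeft → F.stit a w v) :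
    cell a m w = cell a m v := by
  ext h'
  exact and_congr_right fun _ => forall_congr' fun hm =>
    ⟨(F.stit a).trans ((F.stit a).symm (h hm)), (F.stit a).trans (h hm)⟩

/-- The number of agents whose favoured set contains a given world. -/
noncomputable def score [Finite Agent] (D : Agent → Set F.World) (w : F.World) : ℝ :=
  letI := Fintype.ofFinite Agent
  ∑ a, (D a).indicator 1 w

theorem score_le_iff [Finite Agent] {D : Agent → Set F.World} {a : Agent} {w v : F.World}
    (h : ∀ b ≠ a, (w ∈ D b ↔ v ∈ D b)) : score D w ≤ score D v ↔ (w ∈ D a → v ∈ D a) := by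
  let _ := Fintype.ofFinite Agent
  have hle {x y : F.World} {b : Agent} (hb : x ∈ D b → y ∈ D b) :
      (D b).indicator (1 : F.World → ℝ) x ≤ (D b).indicator 1 y := by
    by_cases hx : x ∈ D b
    · simp [hx, hb hx]
    · simp only [Set.indicator_of_notMem hx]
      exact Set.indicator_nonneg (fun _ _ => zero_le_one) _
  constructor
  · intro hs hw
    by_contra hv
    refine hs.not_gt (Finset.sum_lt_sum (fun b _ => hle ?_) ⟨a, Finset.mem_univ a, ?_⟩)
    · by_cases hb : b = a
      · subst hb; exact fun _ => hw
      · exact (h b hb).2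
    · simp [hw, hv]
  · intro ha
    refine Finset.sum_le_sum fun b _ => hle ?_
    by_cases hb : b = a
    · exact hb ▸ ha
    · exact (h b hb).1

/-- Epistemic indistinguishability of indices. -/
def epi (a : Agent) (i j : Idx F.before) : Prop :=
  i.mom.isLeft = j.mom.isLeft ∧ F.know a (worldOf i.hist) (worldOf j.hist)

/-- The indices that every intention of an agent includes. -/
def intentionCore (a : Agent) : Set (Idx F.before) :=
  {j | j.mom.isLeft → worldOf j.hist ∈ F.core a}

theorem mem_exAnte {a : Agent} {i j : Idx F.before} (hi : i.mom.isLeft) :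
    j ∈ exAnte epi a i ↔ j.mom.isLeft ∧ F.info a (worldOf i.hist) (worldOf j.hist) := by
  constructor
  · rintro ⟨h, p, hm, hk⟩
    have hj : j.mom.isLeft := hm.symm.trans hi
    obtain ⟨u, hu, hku⟩ := F.unifH ((F.know a).symm hk) (box_of_mem hj p j.mem)
    exact ⟨hj, u, hu, (F.know a).symm hku⟩
  · rintro ⟨hj, u, hu, hk⟩
    obtain ⟨x, hx, hkx⟩ := F.unifH hk ((F.box).symm hu)
    exact ⟨hist x, mem_of_box hj j.mem hx, hi.trans hj.symm, by simpa using hkx⟩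

theorem inter_exAnte_nonempty (a : Agent) (i : Idx F.before) :
    (intentionCore a ∩ exAnte epi a i).Nonempty := by
  by_cases hi : i.mom.isLeft
  · obtain ⟨v, hv, hu⟩ := F.exists_core a (worldOf i.hist)
    obtain ⟨u, hu, huv⟩ := hu
    obtain ⟨x, hvx, hux⟩ := F.unifH huv ((F.box).symm hu)
    refine ⟨⟨_, hist v, mem_mk v⟩, fun _ => by simpa using hv, hist x, ?_, by simpa using hi, ?_⟩
    · exact .inl (congrArg Sum.inl (Quotient.sound hvx))
    · simpa using hux
  · exact ⟨i, fun h => absurd h hi, i.hist, i.mem, rfl, Setoid.refl' _ _⟩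

/-- The branching-time model of a relational frame. -/
noncomputable def model [Finite Agent] (F : Frame Agent) :
    BiKiobtModel Agent F.Moment F.before where
  ags_fin := inferInstance
  mom_ne := inferInstance
  lt_irrefl := by rintro (q | w) h <;> exact h
  lt_trans := by rintro (_ | _) (_ | _) (_ | _) h h' <;> first | exact h.elim | exact h'.elim
  no_bb := by
    rintro (q | w) (q' | w') (_ | _) h h' <;> first | exact h.elim | exact h'.elim | skip
    exact .inl (congrArg Sum.inl ((show q = _ from h).trans (show q' = _ from h').symm))
  Choice a m := {L | ∃ w, m ∈ (hist w).val ∧ L = cell a m w}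
  choice_sub := by rintro a m _ ⟨w, -, rfl⟩ h hh; exact hh.1
  choice_ne := by
    rintro a m _ ⟨w, hw, rfl⟩
    exact ⟨hist w, hw, fun _ => by simp⟩
  choice_cover a m h hh :=
    ⟨_, ⟨worldOf h, by rwa [hist_worldOf], rfl⟩, mem_cell_self hh⟩
  choice_disj := by
    rintro a m _ ⟨w, -, rfl⟩ _ ⟨v, -, rfl⟩ h hw hv
    exact cell_congr fun hm => (F.stit a).trans (hw.2 hm) ((F.stit a).symm (hv.2 hm))
  nc := by
    rintro a (q | w) (q' | w') hlt h h' - - hh hh' L - hL <;> try exact hlt.elim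
    rwa [← eq_of_mem (by simp) hh hh']
  ia := by
    intro m s hs
    choose ws hws hsw using hs
    by_cases hm : m.isLeft
    · obtain ⟨h, hh⟩ := exists_mem m
      have hbox (a : Agent) : F.box (worldOf h) (ws a) := by
        simpa using box_of_mem hm hh (hws a)
      obtain ⟨v, hv⟩ := F.indep _ ws hbox
      refine ⟨hist v, Set.mem_iInter.2 fun a => ?_⟩
      rw [hsw]
      refine ⟨mem_of_box hm hh ((F.box).trans (hbox a) (F.box_of_stit (hv a))), fun _ => ?_⟩
      simpa using hv a
    · obtain ⟨h, hh⟩ := exists_mem m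
      refine ⟨h, Set.mem_iInter.2 fun a => ?_⟩
      rw [hsw]
      exact ⟨hh, fun h => absurd h hm⟩
  epi := epi
  epi_equiv a := ⟨fun _ => ⟨rfl, Setoid.refl' _ _⟩, fun h => ⟨h.1.symm, Setoid.symm' _ h.2⟩,
    fun h h' => ⟨h.1.trans h'.1, Setoid.trans' _ h.2 h'.2⟩⟩
  oac := by
    rintro a i j hij _ ⟨w, -, rfl⟩ hi h' hh' p
    by_cases hm : i.mom.isLeft
    · exact ⟨hij.1, (F.know a).trans (F.know_of_stit
        ((F.stit a).trans ((F.stit a).symm (hh'.2 hm)) (hi.2 hm))) hij.2⟩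
    · obtain rfl := eq_of_mem hm i.mem p
      exact hij
  unifH := by
    intro a i j hij h' p
    by_cases hm : i.mom.isLeft
    · obtain ⟨v, hv, hv'⟩ := F.unifH hij.2 (box_of_mem hm i.mem p)
      exact ⟨hist v, mem_of_box (hij.1 ▸ hm) j.mem hv, hij.1, by simpa using hv'⟩
    · obtain rfl := eq_of_mem hm i.mem p
      exact ⟨j.hist, j.mem, hij⟩
  tau a i := {U | U ⊆ exAnte epi a i ∧ (U = ∅ ∨ intentionCore a ∩ exAnte epi a i ⊆ U)}
  tau_sub a i U hU := hU.1
  tau_univ a i := ⟨subset_rfl, .inr Set.inter_subset_right⟩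
  tau_empty a i := ⟨Set.empty_subset _, .inl rfl⟩
  tau_inter := by
    rintro a i U V ⟨hU, hU'⟩ ⟨hV, hV'⟩
    refine ⟨Set.inter_subset_left.trans hU, ?_⟩
    rcases hU' with rfl | hU'
    · exact .inl (Set.empty_inter _)
    rcases hV' with rfl | hV'
    · exact .inl (Set.inter_empty _)
    exact .inr (Set.subset_inter hU' hV')
  tau_sUnion := by
    intro a i S hS
    refine ⟨Set.sUnion_subset fun U hU => (hS hU).1, ?_⟩
    by_cases h : ∃ U ∈ S, U ≠ ∅
    · obtain ⟨U, hU, hne⟩ := h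
      exact .inr (((hS hU).2.resolve_left hne).trans (Set.subset_sUnion_of_mem hU))
    · exact .inl (Set.sUnion_eq_empty.2 fun U hU => by_contra fun hne => h ⟨U, hU, hne⟩)
  tau_ci := by
    rintro a i U V ⟨-, hU⟩ ⟨-, hV⟩ hUne hVne
    exact (inter_exAnte_nonempty a i).mono (Set.subset_inter (hU.resolve_left hUne.ne_empty)
      (hV.resolve_left hVne.ne_empty))
  tau_ki := by intro a i j hij; simp only [hij]
  ValueO h := score F.bestO (worldOf h)
  ValueS h := score F.bestS (worldOf h)
  val n := {i | worldOf i.hist ∈ F.val n}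

variable [Finite Agent]

theorem finiteChoice_model (F : Frame Agent) : FiniteChoice F.model := by
  intro a m
  obtain ⟨ι, _, c, hc⟩ := F.fin_choice a
  have hrep (L : F.model.Choice a m) : ∃ w, m ∈ (hist w).val ∧ L.1 = cell a m w := L.2
  choose r hr hL using hrep
  have hinj : Function.Injective fun L => c (r L) := fun L L' h => Subtype.ext <| by
    rw [hL, hL]
    exact cell_congr fun hm => hc _ _ (by simpa using box_of_mem hm (hr L) (hr L')) h
  exact Set.finite_coe_iff.1 (Finite.of_injective _ hinj)

theorem stit_of_mem_state {a b : Agent} {m : F.Moment} (hm : m.isLeft) {S : Set (Hist F.before)}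
    (hS : S ∈ stateSet F.model a m) {h h' : Hist F.before} (hh : h ∈ S) (hh' : h' ∈ S)
    (hb : b ≠ a) : F.stit b (worldOf h) (worldOf h') := by
  obtain ⟨s, hs, rfl⟩ := hS
  obtain ⟨w, -, hsw⟩ := hs b
  have h₁ : h ∈ s b := Set.mem_iInter₂.1 hh b hb
  have h₂ : h' ∈ s b := Set.mem_iInter₂.1 hh' b hb
  rw [hsw] at h₁ h₂
  exact (F.stit b).trans ((F.stit b).symm (h₁.2 hm)) (h₂.2 hm)

theorem exists_state {a : Agent} {m : F.Moment} {w v : F.World} (hw : m ∈ (hist w).val)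
    (hv : m ∈ (hist v).val) : ∃ S ∈ stateSet F.model a m,
      (cell a m w ∩ S).Nonempty ∧ (cell a m v ∩ S).Nonempty := by
  classical
  have key (u : F.World) (hu : m ∈ (hist u).val) :
      (cell a m u ∩ ⋂ b ∈ {b | b ≠ a}, cell b m w).Nonempty := by
    obtain ⟨h, hh⟩ := F.model.ia m (fun b => if b = a then cell b m u else cell b m w) fun b => by
      split_ifs
      · exact ⟨u, hu, rfl⟩
      · exact ⟨w, hw, rfl⟩
    rw [Set.mem_iInter] at hh
    refine ⟨h, by simpa using hh a, Set.mem_iInter₂.2 fun b hb => ?_⟩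
    have := hh b
    rwa [if_neg hb] at this
  exact ⟨_, ⟨fun b => cell b m w, fun b => ⟨w, hw, rfl⟩, rfl⟩, key w hw, key v hv⟩

theorem domO_iff {a : Agent} {m : F.Moment} (hm : m.isLeft) {w v : F.World}
    (hw : m ∈ (hist w).val) (hv : m ∈ (hist v).val) :
    domO F.model a m (cell a m w) (cell a m v) ↔ (w ∈ F.bestO a → v ∈ F.bestO a) := by
  have agree {S : Set (Hist F.before)} (hS : S ∈ stateSet F.model a m) {h h' : Hist F.before}
      (hh : h ∈ cell a m w ∩ S) (hh' : h' ∈ cell a m v ∩ S) :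
      F.model.ValueO h ≤ F.model.ValueO h' ↔ (w ∈ F.bestO a → v ∈ F.bestO a) := by
    refine (score_le_iff fun b hb => ?_).trans
      (imp_congr ⟨?_, F.bestO_stit (hh.1.2 hm)⟩ ⟨?_, F.bestO_stit (hh'.1.2 hm)⟩)
    · have := stit_of_mem_state hm hS hh.2 hh'.2 hb
      exact ⟨F.bestO_stit this, F.bestO_stit ((F.stit b).symm this)⟩
    · exact F.bestO_stit ((F.stit a).symm (hh.1.2 hm))
    · exact F.bestO_stit ((F.stit a).symm (hh'.1.2 hm))
  constructor
  · intro hd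
    obtain ⟨S, hS, ⟨h, hh⟩, ⟨h', hh'⟩⟩ := exists_state (a := a) hw hv
    exact (agree hS hh hh').1 (hd S hS h hh h' hh')
  · exact fun himp S hS h hh h' hh' => (agree hS hh hh').2 himp

theorem know_of_mem_cluster {a : Agent} {m n : F.Moment} (hm : m.isLeft) {w : F.World}
    {h : Hist F.before} (hh : h ∈ cluster F.model a m (cell a m w) n) :
    n.isLeft ∧ n ∈ h.val ∧ F.know a w (worldOf h) := by
  obtain ⟨p, h', hh', q, hn, hk⟩ := hh
  exact ⟨hn.symm.trans hm, p, (F.know a).trans (F.know_of_stit (hh'.2 hm)) hk⟩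

theorem mem_cluster {a : Agent} {m n : F.Moment} {w : F.World} {h h' : Hist F.before}
    (hh : h ∈ cell a m w) (hh' : n ∈ h'.val) (hmn : m.isLeft = n.isLeft)
    (hk : F.know a (worldOf h) (worldOf h')) : h' ∈ cluster F.model a m (cell a m w) n :=
  ⟨hh', h, hh, hh.1, hmn, hk⟩

theorem domS_iff {a : Agent} {m : F.Moment} (hm : m.isLeft) {w v : F.World}
    (hw : m ∈ (hist w).val) (hv : m ∈ (hist v).val) :
    domS F.model a m (cell a m w) (cell a m v) ↔ (w ∈ F.bestS a → v ∈ F.bestS a) := by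
  have agree {n : F.Moment} {S : Set (Hist F.before)} (hS : S ∈ stateSet F.model a n)
      {h h' : Hist F.before} (hh : h ∈ cluster F.model a m (cell a m w) n ∩ S)
      (hh' : h' ∈ cluster F.model a m (cell a m v) n ∩ S) :
      F.model.ValueS h ≤ F.model.ValueS h' ↔ (w ∈ F.bestS a → v ∈ F.bestS a) := by
    obtain ⟨hn, -, hk⟩ := know_of_mem_cluster hm hh.1
    obtain ⟨-, -, hk'⟩ := know_of_mem_cluster hm hh'.1
    refine (score_le_iff fun b hb => ?_).trans
      (imp_congr ⟨?_, F.bestS_know hk⟩ ⟨?_, F.bestS_know hk'⟩)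
    · have := F.know_of_stit (stit_of_mem_state hn hS hh.2 hh'.2 hb)
      exact ⟨F.bestS_know this, F.bestS_know ((F.know b).symm this)⟩
    · exact F.bestS_know ((F.know a).symm hk)
    · exact F.bestS_know ((F.know a).symm hk')
  constructor
  · intro hd
    obtain ⟨S, hS, ⟨h, hh, hhS⟩, ⟨h', hh', hhS'⟩⟩ := exists_state (a := a) hw hv
    have hc {u : F.World} {h : Hist F.before} (hh : h ∈ cell a m u) :
        h ∈ cluster F.model a m (cell a m u) m :=
      mem_cluster hh hh.1 rfl (Setoid.refl' _ _)
    have hmm : momRel F.model a m m :=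
      ⟨⟨m, h, hh.1⟩, ⟨m, h, hh.1⟩, rfl, rfl, (F.model.epi_equiv a).refl _⟩
    exact (agree hS ⟨hc hh, hhS⟩ ⟨hc hh', hhS'⟩).1
      (hd m hmm S hS h ⟨hc hh, hhS⟩ h' ⟨hc hh', hhS'⟩)
  · exact fun himp n _ S hS h hh h' hh' => (agree hS hh hh').2 himp

theorem cell_mem_optimal {a : Agent} {m : F.Moment} (hm : m.isLeft) {w : F.World}
    (hw : m ∈ (hist w).val) : cell a m w ∈ optimal F.model a m ↔ w ∈ F.bestO a := by
  constructor
  · rintro ⟨-, hopt⟩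
    by_contra hn
    obtain ⟨v, hv, hwv⟩ := F.exists_bestO a w
    have hv' : m ∈ (hist v).val := mem_of_box hm hw (by simpa using hwv)
    refine hopt ⟨_, ⟨v, hv', rfl⟩, (domO_iff hm hw hv').2 fun _ => hv, fun h => hn ?_⟩
    exact (domO_iff hm hv' hw).1 h hv
  · rintro hbest
    refine ⟨⟨w, hw, rfl⟩, ?_⟩
    rintro ⟨_, ⟨v, hv, rfl⟩, -, hnot⟩
    exact hnot ((domO_iff hm hv hw).2 fun _ => hbest)

theorem cell_mem_soptimal {a : Agent} {m : F.Moment} (hm : m.isLeft) {w : F.World}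
    (hw : m ∈ (hist w).val) : cell a m w ∈ soptimal F.model a m ↔ w ∈ F.bestS a := by
  constructor
  · rintro ⟨-, hopt⟩
    by_contra hn
    obtain ⟨v, hv, hwv⟩ := F.exists_bestS a w
    have hv' : m ∈ (hist v).val := mem_of_box hm hw (by simpa using hwv)
    refine hopt ⟨_, ⟨v, hv', rfl⟩, (domS_iff hm hw hv').2 fun _ => hv, fun h => hn ?_⟩
    exact (domS_iff hm hv' hw).1 h hv
  · rintro hbest
    refine ⟨⟨w, hw, rfl⟩, ?_⟩
    rintro ⟨_, ⟨v, hv, rfl⟩, -, hnot⟩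
    exact hnot ((domS_iff hm hv hw).2 fun _ => hbest)

theorem truth_model (ψ : Formula Agent) (i : Idx F.before) (hi : i.mom.isLeft) :
    truth F.model ψ i ↔ F.sat ψ (worldOf i.hist) := by
  have at_world {ψ : Formula Agent}
      (ih : ∀ i : Idx F.before, i.mom.isLeft → (truth F.model ψ i ↔ F.sat ψ (worldOf i.hist)))
      {m : F.Moment} (hm : m.isLeft) {w : F.World} (hw : m ∈ (hist w).val) :
      truth F.model ψ ⟨m, hist w, hw⟩ ↔ F.sat ψ w := by
    simpa using ih ⟨m, hist w, hw⟩ hm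
  induction ψ generalizing i with
  | atom n => rfl
  | neg φ ih => exact not_congr (ih i hi)
  | conj φ ψ ih ih' => exact and_congr (ih i hi) (ih' i hi)
  | box φ ih =>
    constructor
    · intro h v hv
      exact (at_world ih hi (mem_of_box hi i.mem hv)).1 (h _ _)
    · intro h h' p
      exact (ih ⟨i.mom, h', p⟩ hi).2 (h _ (box_of_mem hi i.mem p))
  | stit a φ ih =>
    constructor
    · intro h v hv
      have hmem := mem_of_box hi i.mem (F.box_of_stit hv)
      refine (at_world ih hi hmem).1 (h (cell a i.mom (worldOf i.hist)) ⟨_, ?_, rfl⟩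
        (mem_cell_self i.mem) _ ⟨hmem, fun _ => by simpa using hv⟩ _)
      rw [hist_worldOf]
      exact i.mem
    · rintro h _ ⟨w, -, rfl⟩ hw h' hh' p
      exact (ih ⟨i.mom, h', p⟩ hi).2
        (h _ ((F.stit a).trans ((F.stit a).symm (hw.2 hi)) (hh'.2 hi)))
  | know a φ ih =>
    constructor
    · intro h v hv
      exact (at_world ih rfl (mem_mk v)).1 (h _ ⟨hi, by simpa using hv⟩)
    · intro h j hj
      exact (ih j (hj.1.symm.trans hi)).2 (h _ hj.2)
  | intend a φ ih =>
    constructor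
    · rintro ⟨U, ⟨-, hU⟩, hne, hφ⟩ v hv hiv
      refine (at_world ih rfl (mem_mk v)).1 (hφ _ (hU.resolve_left hne.ne_empty ⟨?_, ?_⟩))
      · exact fun _ => by simpa using hv
      · exact (mem_exAnte hi).2 ⟨rfl, by simpa using hiv⟩
    · intro h
      refine ⟨_, ⟨Set.inter_subset_right, .inr subset_rfl⟩, inter_exAnte_nonempty a i, ?_⟩
      rintro j ⟨hj, hij⟩
      obtain ⟨hjl, hij⟩ := (mem_exAnte hi).1 hij
      exact (ih j hjl).2 (h _ (hj hjl) hij)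
  | oughtO a φ ih =>
    constructor
    · intro h v hv hwv
      have hmem := mem_of_box hi i.mem hwv
      exact (at_world ih hi hmem).1 (h _ ((cell_mem_optimal hi hmem).2 hv) _
        ⟨hmem, fun _ => by simp⟩ _)
    · rintro h L hL h' hh' p
      obtain ⟨w, hw, rfl⟩ := hL.1
      exact (ih ⟨i.mom, h', p⟩ hi).2 (h _ (F.bestO_stit (hh'.2 hi) ((cell_mem_optimal hi hw).1 hL))
        (box_of_mem hi i.mem p))
  | oughtS a φ ih =>
    constructor
    · rintro h v hv ⟨u, hwu, huv⟩
      have hmem := mem_of_box hi i.mem hwu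
      have hu := F.bestS_know ((F.know a).symm huv) hv
      have hself : hist u ∈ cell a i.mom u := ⟨hmem, fun _ => by simp⟩
      exact (at_world ih rfl (mem_mk v)).1 (h _ ((cell_mem_soptimal hi hmem).2 hu) _
        ⟨⟨i.mom, hist u, hmem⟩, ⟨_, hist v, mem_mk v⟩, rfl, rfl, hi, by simpa using huv⟩ _
        (mem_cluster hself (mem_mk v) hi (by simpa using huv)) _)
    · rintro h L hL n - h' hh' p
      obtain ⟨w, hw, rfl⟩ := hL.1
      obtain ⟨hn, -, hk⟩ := know_of_mem_cluster hi hh'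
      exact (ih ⟨n, h', p⟩ hn).2 (h _ (F.bestS_know hk ((cell_mem_soptimal hi hw).1 hL))
        ⟨w, by simpa using box_of_mem hi i.mem hw, hk⟩)

end BranchingTime

end Frame

/-! ### Coarsening the canonical frame -/

section Canonical

variable {w v u : World Agent} {φ ψ : Formula Agent} {a : Agent}

theorem oughtO_mem_of_box (h : acc .box w v) (ψ : Formula Agent) (hψ : ψ.oughtO a ∈ w.1) :
    ψ.oughtO a ∈ v.1 := s5_box.mem_of_acc h (mem_of_imp (.a3 a ψ) hψ)

theorem oughtS_mem_of_info (h : info a w v) (ψ : Formula Agent) (hψ : ψ.oughtS a ∈ w.1) :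
    ψ.oughtS a ∈ v.1 := mem_of_info h (mem_of_imp (.sCl a ψ) hψ)

theorem intend_mem_of_info (h : info a w v) (ψ : Formula Agent) (hψ : ψ.intend a ∈ w.1) :
    ψ.intend a ∈ v.1 := mem_of_info' h (mem_of_imp (.ki a ψ) hψ)

theorem box_of_oughtO (h : ∀ ψ : Formula Agent, ψ.oughtO a ∈ w.1 → ψ ∈ v.1) : acc .box w v :=
  s5_box.acc_of_forall fun ψ hψ => h ψ (mem_of_imp (.a2 a ψ) hψ)

theorem info_of_oughtS (h : ∀ ψ : Formula Agent, ψ.oughtS a ∈ w.1 → ψ ∈ v.1) : info a w v :=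
  info_of_forall_know_box fun ψ hψ => h ψ (mem_of_imp (.suN a ψ) hψ)

theorem info_of_intend (h : ∀ ψ : Formula Agent, ψ.intend a ∈ w.1 → ψ ∈ v.1) : info a w v :=
  info_of_forall_box_know fun ψ hψ => h ψ (mem_of_imp (.inN a ψ) hψ)

theorem oughtO_iff :
    φ.oughtO a ∈ w.1 ↔ ∀ v ∈ ideal (.oughtO a), acc .box w v → φ ∈ v.1 :=
  (normal_oughtO a).mem_iff_ideal oughtO_mem_of_box box_of_oughtO

theorem oughtS_iff :
    φ.oughtS a ∈ w.1 ↔ ∀ v ∈ ideal (.oughtS a), info a w v → φ ∈ v.1 :=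
  (normal_oughtS a).mem_iff_ideal oughtS_mem_of_info info_of_oughtS

theorem intend_iff :
    φ.intend a ∈ w.1 ↔ ∀ v ∈ ideal (.intend a), info a w v → φ ∈ v.1 :=
  (normal_intend a).mem_iff_ideal intend_mem_of_info info_of_intend

theorem exists_ideal_oughtO (a : Agent) (w : World Agent) :
    ∃ v ∈ ideal (.oughtO a), acc .box w v :=
  (normal_oughtO a).exists_ideal oughtO_mem_of_box box_of_oughtO fun h =>
    mem_diam.1 (mem_of_imp (.oic a .bot) h) <| s5_box.mem_iff.2 fun _ _ => mem_neg.2 fun h =>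
      bot_notMem (mem_of_imp (.stitT a .bot) h)

theorem exists_ideal_oughtS (a : Agent) (w : World Agent) :
    ∃ v ∈ ideal (.oughtS a), info a w v :=
  (normal_oughtS a).exists_ideal oughtS_mem_of_info info_of_oughtS fun h =>
    mem_diam.1 (mem_of_imp (.sOic a .bot) h) <| s5_box.mem_iff.2 fun _ _ => mem_neg.2 fun h =>
      bot_notMem (mem_of_imp (.knowT a .bot) h)

theorem exists_ideal_intend (a : Agent) (w : World Agent) :
    ∃ v ∈ ideal (.intend a), info a w v :=
  (normal_intend a).exists_ideal intend_mem_of_info info_of_intend fun h =>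
    mem_neg.1 (mem_of_imp (.intD a .bot) h) <| mem_of_thm <| .necInt a <|
      .of_forall_mem fun _ => mem_neg.2 bot_notMem

/-- Epistemic indistinguishability up to the knowledge of formulas in `S`. -/
def coarseKnow (S : Set (Formula Agent)) (a : Agent) : Setoid (World Agent) where
  r w v := info a w v ∧ ∀ ψ ∈ S, (ψ.know a ∈ w.1 ↔ ψ.know a ∈ v.1)
  iseqv := ⟨fun _ => ⟨Setoid.refl' _ _, fun _ _ => .rfl⟩,
    fun h => ⟨Setoid.symm' _ h.1, fun ψ hψ => (h.2 ψ hψ).symm⟩,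
    fun h h' => ⟨Setoid.trans' _ h.1 h'.1, fun ψ hψ => (h.2 ψ hψ).trans (h'.2 ψ hψ)⟩⟩

/-- Choice equivalence up to what is known and what is seen to in `S`. -/
def coarseStit (S : Set (Formula Agent)) (a : Agent) : Setoid (World Agent) where
  r w v := acc .box w v ∧ (∀ ψ ∈ S, (ψ.know a ∈ w.1 ↔ ψ.know a ∈ v.1)) ∧
    ∀ ψ ∈ S, (ψ.stit a ∈ w.1 ↔ ψ.stit a ∈ v.1)
  iseqv := ⟨fun _ => ⟨Setoid.refl' _ _, fun _ _ => .rfl, fun _ _ => .rfl⟩,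
    fun h => ⟨Setoid.symm' _ h.1, fun ψ hψ => (h.2.1 ψ hψ).symm, fun ψ hψ => (h.2.2 ψ hψ).symm⟩,
    fun h h' => ⟨Setoid.trans' _ h.1 h'.1, fun ψ hψ => (h.2.1 ψ hψ).trans (h'.2.1 ψ hψ),
      fun ψ hψ => (h.2.2 ψ hψ).trans (h'.2.2 ψ hψ)⟩⟩

variable {S : Set (Formula Agent)}

theorem coarseKnow_of_acc (h : acc (.know a) w v) : coarseKnow S a w v :=
  ⟨info_of_know h, fun ψ _ => h ψ⟩

theorem coarseStit_of_acc (h : acc (.stit a) w v) : coarseStit S a w v :=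
  ⟨acc_box_of_stit h, fun ψ _ => acc_know_of_stit h ψ, fun ψ _ => h ψ⟩

theorem exists_box_coarseKnow (h : info a w v) : ∃ u, acc .box w u ∧ coarseKnow S a u v :=
  (exists_box_know h).imp fun _ hu => ⟨hu.1, coarseKnow_of_acc hu.2⟩

/-- The canonical frame coarsened by a finite set of formulas. -/
def coarseFrame [Finite Agent] [Nonempty (World Agent)] (S : Set (Formula Agent)) (hS : S.Finite) :
    Frame Agent where
  World := World Agent
  nonempty := inferInstance
  box := acc .box
  stit := coarseStit S
  know := coarseKnow S
  box_of_stit h := h.1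
  know_of_stit h := ⟨info_of_box h.1, h.2.1⟩
  unifH {a _ _ _} h h' := by
    obtain ⟨u, hu, hk⟩ := exists_box_coarseKnow (S := S)
      ((info a).trans ((info a).symm h.1) (info_of_box h'))
    exact ⟨u, hu, Setoid.symm' _ hk⟩
  indep _ ws h := (acc_independence ws h).imp fun _ hv a => coarseStit_of_acc (hv a)
  fin_choice a :=
    have := hS.to_subtype
    ⟨Set S × Set S, inferInstance,
      fun w => ({ψ | ψ.1.know a ∈ w.1}, {ψ | ψ.1.stit a ∈ w.1}),
      fun w v hbox h => ⟨hbox, fun ψ hψ => Set.ext_iff.1 (Prod.ext_iff.1 h).1 ⟨ψ, hψ⟩,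
        fun ψ hψ => Set.ext_iff.1 (Prod.ext_iff.1 h).2 ⟨ψ, hψ⟩⟩⟩
  bestO a := {v | ∃ u ∈ ideal (.oughtO a), coarseStit S a v u}
  bestO_stit := fun h ⟨u, hu, hwu⟩ => ⟨u, hu, Setoid.trans' _ (Setoid.symm' _ h) hwu⟩
  exists_bestO a w :=
    (exists_ideal_oughtO a w).imp fun v hv => ⟨⟨v, hv.1, Setoid.refl' _ _⟩, hv.2⟩
  bestS a := {v | ∃ u ∈ ideal (.oughtS a), coarseKnow S a v u}
  bestS_know := fun h ⟨u, hu, hwu⟩ => ⟨u, hu, Setoid.trans' _ (Setoid.symm' _ h) hwu⟩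
  exists_bestS a w := by
    obtain ⟨v, hv, hwv⟩ := exists_ideal_oughtS a w
    obtain ⟨u, hu, huv⟩ := exists_box_coarseKnow hwv
    exact ⟨u, ⟨v, hv, huv⟩, hu⟩
  core a := ideal (.intend a)
  exists_core a w :=
    (exists_ideal_intend a w).imp fun _ hv => ⟨hv.1, exists_box_coarseKnow hv.2⟩
  val n := {w | .atom n ∈ w.1}

theorem coarseFrame_info [Finite Agent] [Nonempty (World Agent)] {hS : S.Finite} :
    (coarseFrame S hS).info a w v ↔ info a w v :=
  ⟨fun ⟨_, hu, huv⟩ => (info a).trans (info_of_box hu) huv.1, exists_box_coarseKnow⟩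

/-- The subformulas of a formula. -/
def Formula.subformulas : Formula Agent → Set (Formula Agent)
  | .atom n => {.atom n}
  | .neg φ => insert φ.neg φ.subformulas
  | .conj φ ψ => insert (.conj φ ψ) (φ.subformulas ∪ ψ.subformulas)
  | .box φ => insert φ.box φ.subformulas
  | .stit a φ => insert (φ.stit a) φ.subformulas
  | .know a φ => insert (φ.know a) φ.subformulas
  | .intend a φ => insert (φ.intend a) φ.subformulas
  | .oughtO a φ => insert (φ.oughtO a) φ.subformulas
  | .oughtS a φ => insert (φ.oughtS a) φ.subformulas

theorem Formula.finite_subformulas (φ : Formula Agent) : φ.subformulas.Finite := by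
  induction φ with
  | atom n => exact Set.finite_singleton _
  | conj φ ψ ih ih' => exact (ih.union ih').insert _
  | _ => exact Set.Finite.insert _ ‹_›

theorem Formula.mem_subformulas (φ : Formula Agent) : φ ∈ φ.subformulas := by
  cases φ <;> simp [Formula.subformulas]

theorem sat_coarseFrame [Finite Agent] [Nonempty (World Agent)] (hS : S.Finite)
    (φ : Formula Agent) (hφ : φ.subformulas ⊆ S) (w : World Agent) :
    (coarseFrame S hS).sat φ w ↔ φ ∈ w.1 := by
  induction φ generalizing w with
  | atom n => rfl
  | neg φ ih =>
    have ih := ih ((Set.subset_insert _ _).trans hφ)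
    exact (not_congr (ih w)).trans mem_neg.symm
  | conj φ ψ ih ih' =>
    have hsub := (Set.subset_insert _ _).trans hφ
    exact (and_congr (ih (Set.subset_union_left.trans hsub) w)
      (ih' (Set.subset_union_right.trans hsub) w)).trans mem_conj.symm
  | box φ ih =>
    have ih := ih ((Set.subset_insert _ _).trans hφ)
    exact (forall₂_congr fun v _ => ih v).trans s5_box.mem_iff.symm
  | stit a φ ih =>
    have hsub := (Set.subset_insert _ _).trans hφ
    refine (forall₂_congr fun v _ => ih hsub v).trans ⟨fun h => ?_, fun h v hv => ?_⟩
    · exact (s5_stit a).mem_iff.2 fun v hv => h v (coarseStit_of_acc hv)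
    · exact mem_of_imp (.stitT a φ) ((hv.2.2 φ (hsub φ.mem_subformulas)).1 h)
  | know a φ ih =>
    have hsub := (Set.subset_insert _ _).trans hφ
    refine (forall₂_congr fun v _ => ih hsub v).trans ⟨fun h => ?_, fun h v hv => ?_⟩
    · exact (s5_know a).mem_iff.2 fun v hv => h v (coarseKnow_of_acc hv)
    · exact mem_of_imp (.knowT a φ) ((hv.2 φ (hsub φ.mem_subformulas)).1 h)
  | intend a φ ih =>
    have ih := ih ((Set.subset_insert _ _).trans hφ)
    exact (forall₃_congr fun v _ _ => ih v).trans <|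
      (forall₂_congr fun v _ => imp_congr_left coarseFrame_info).trans intend_iff.symm
  | oughtO a φ ih =>
    have hsub := (Set.subset_insert _ _).trans hφ
    refine (forall₃_congr fun v _ _ => ih hsub v).trans ⟨fun h => ?_, ?_⟩
    · exact oughtO_iff.2 fun v hv => h v ⟨v, hv, Setoid.refl' _ _⟩
    · rintro h v ⟨u, hu, hvu⟩ hwv
      have hφu : φ.stit a ∈ u.1 := oughtO_iff.1 (mem_of_imp (.a4 a φ) h) u hu
        (Setoid.trans' _ hwv hvu.1)
      exact mem_of_imp (.stitT a φ) ((hvu.2.2 φ (hsub φ.mem_subformulas)).2 hφu)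
  | oughtS a φ ih =>
    have hsub := (Set.subset_insert _ _).trans hφ
    refine (forall₃_congr fun v _ _ => ih hsub v).trans ⟨fun h => ?_, ?_⟩
    · exact oughtS_iff.2 fun v hv hwv =>
        h v ⟨v, hv, Setoid.refl' _ _⟩ (coarseFrame_info.2 hwv)
    · rintro h v ⟨u, hu, hvu⟩ hwv
      have hφu : φ.know a ∈ u.1 := oughtS_iff.1 (mem_of_imp (.a6 a φ) h) u hu
        (Setoid.trans' _ (coarseFrame_info.1 hwv) hvu.1)
      exact mem_of_imp (.knowT a φ) ((hvu.2 φ (hsub φ.mem_subformulas)).2 hφu)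

end Canonical

/-- completeness of `Λ_R'` with respect to finite-choice
bi-valued kiobt-models. -/
theorem Lambda_R'_complete {Agent : Type} [Finite Agent]
    (φ : Formula Agent) (hcon : ¬ Lambda_R' (Formula.neg φ)) :
    ∃ (Mom : Type) (lt : Mom → Mom → Prop) (M : BiKiobtModel Agent Mom lt),
      FiniteChoice M ∧ ∃ i : Idx lt, truth M φ i := by
  obtain ⟨w, hw⟩ : ∃ w : World Agent, φ ∈ w.1 := by
    by_contra! h
    exact hcon (.of_forall_mem fun w => mem_neg.2 (h w))
  have : Nonempty (World Agent) := ⟨w⟩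
  let F := coarseFrame φ.subformulas φ.finite_subformulas
  obtain ⟨u, hu⟩ : ∃ u : F.World, F.sat φ u := ⟨w, (sat_coarseFrame _ φ subset_rfl w).2 hw⟩
  exact ⟨F.Moment, F.before, F.model, F.finiteChoice_model, ⟨_, _, Frame.mem_mk u⟩,
    (Frame.truth_model φ _ rfl).2 (by simpa using hu)⟩

end IEAUST
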